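/- Let B denote the space of bounded measurable real functions on [0,1], let A : B → B be linear with a measurable ω : [0,1]² → [0,∞) satisfying ∫₀¹ ω(u,s) du ≤ 1 for every s and |(Ah)(s)| ≤ ∫₀¹ |h(u)| ω(u,s) du for all h ∈ B and s ∈ [0,1]. Let α, α̂, β, β̂ ∈ B with sup_s |α(s)| ≤ ᾱ, sup_s |β(s)| ≤ β̄, sup_s |α̂(s) − α(s)| ≤ c, and sup_s |β̂(s) − β(s)| ≤ c for some constants ᾱ, β̄, c ≥ 0. Define γ(h,s) := α(s)·(Ah)(s) and γ̂(h,s) := α̂(s)·(Ah)(s), with iterates γ⁰(h,s) := h(s), γ^ℓ(h,s) := γ(γ^{ℓ−1}(h,·), s), and similarly for γ̂. Then for every integer ℓ ≥ 1, sup_{s∈[0,1]} |γ̂^ℓ(β̂,s) − γ^ℓ(β,s)| ≤ c(ᾱ + c)^ℓ + c β̄ ℓ (ᾱ + c)^{ℓ−1}. -/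

import Mathlib

open MeasureTheory

/-- Membership in `B`, the space of bounded measurable real functions on `[0,1]`
(modelled as measurable functions `ℝ → ℝ` that are bounded on `[0,1]`). -/
def IsBddMeas (h : ℝ → ℝ) : Prop :=
  Measurable h ∧ ∃ M : ℝ, ∀ s ∈ Set.Icc (0 : ℝ) 1, |h s| ≤ M

/-- The iterates `γ⁰(h,s) = h(s)`, `γ^ℓ(h,s) = α(s) · (A γ^{ℓ−1}(h,·))(s)`. -/
noncomputable def gammaIter (α : ℝ → ℝ) (A : (ℝ → ℝ) → ℝ → ℝ) : ℕ → (ℝ → ℝ) → ℝ → ℝ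
  | 0, h => h
  | ℓ + 1, h => fun s => α s * A (gammaIter α A ℓ h) s

lemma IsBddMeas.mul {f g : ℝ → ℝ} (hf : IsBddMeas f) (hg : IsBddMeas g) :
    IsBddMeas (fun s => f s * g s) := by
  obtain ⟨hfm, M, hM⟩ := hf
  obtain ⟨hgm, N, hN⟩ := hg
  refine ⟨hfm.mul hgm, M * N, fun s hs => ?_⟩
  rw [abs_mul]
  exact mul_le_mul (hM s hs) (hN s hs) (abs_nonneg _) ((abs_nonneg _).trans (hM s hs))

lemma IsBddMeas.const_smul {f : ℝ → ℝ} (hf : IsBddMeas f) (c : ℝ) : IsBddMeas (c • f) :=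
  IsBddMeas.mul ⟨measurable_const, |c|, fun _ _ => le_rfl⟩ hf

lemma IsBddMeas.add {f g : ℝ → ℝ} (hf : IsBddMeas f) (hg : IsBddMeas g) :
    IsBddMeas (f + g) := by
  obtain ⟨hfm, M, hM⟩ := hf
  obtain ⟨hgm, N, hN⟩ := hg
  exact ⟨hfm.add hgm, M + N, fun s hs =>
    (abs_add_le _ _).trans (add_le_add (hM s hs) (hN s hs))⟩

lemma IsBddMeas.sub {f g : ℝ → ℝ} (hf : IsBddMeas f) (hg : IsBddMeas g) :
    IsBddMeas (f - g) := by
  simpa [sub_eq_add_neg] using hf.add (hg.const_smul (-1))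

lemma IsBddMeas.gammaIter {α : ℝ → ℝ} {A : (ℝ → ℝ) → ℝ → ℝ}
    (hAB : ∀ h, IsBddMeas h → IsBddMeas (A h)) (hα : IsBddMeas α) {h : ℝ → ℝ}
    (hh : IsBddMeas h) : ∀ ℓ, IsBddMeas (gammaIter α A ℓ h)
  | 0 => hh
  | ℓ + 1 => hα.mul (hAB _ (IsBddMeas.gammaIter hAB hα hh ℓ))

/-- Integration against a sub-probability density does not increase the sup norm. -/
lemma setIntegral_abs_mul_le_of_lintegral_le_one {μ : Measure ℝ} {S : Set ℝ}
    (hS : MeasurableSet S) {h w : ℝ → ℝ} (hw : Measurable w) (hw0 : ∀ u, 0 ≤ w u)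
    (hw1 : ∫⁻ u in S, ENNReal.ofReal (w u) ∂μ ≤ 1) {M : ℝ} (hM0 : 0 ≤ M)
    (hM : ∀ u ∈ S, |h u| ≤ M) : ∫ u in S, |h u| * w u ∂μ ≤ M := by
  have hint : IntegrableOn w S μ := by
    refine ⟨hw.aestronglyMeasurable, ?_⟩
    rw [hasFiniteIntegral_iff_ofReal (ae_of_all _ hw0)]
    exact hw1.trans_lt ENNReal.one_lt_top
  have hone : ∫ u in S, w u ∂μ ≤ 1 := by
    rw [integral_eq_lintegral_of_nonneg_ae (ae_of_all _ hw0) hw.aestronglyMeasurable]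
    exact ENNReal.toReal_mono ENNReal.one_ne_top hw1
  calc ∫ u in S, |h u| * w u ∂μ ≤ ∫ u in S, M * w u ∂μ := by
        refine integral_mono_of_nonneg
          (ae_of_all _ fun u => mul_nonneg (abs_nonneg _) (hw0 u)) (hint.const_mul M) ?_
        filter_upwards [ae_restrict_mem hS] with u hu
        exact mul_le_mul_of_nonneg_right (hM u hu) (hw0 u)
    _ = M * ∫ u in S, w u ∂μ := integral_const_mul _ _
    _ ≤ M := mul_le_of_le_one_right hM0 hone

lemma abs_gammaIter_le {α : ℝ → ℝ} {A : (ℝ → ℝ) → ℝ → ℝ}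
    (hAB : ∀ h, IsBddMeas h → IsBddMeas (A h))
    (hA : ∀ h, IsBddMeas h → ∀ M : ℝ, (∀ u ∈ Set.Icc (0 : ℝ) 1, |h u| ≤ M) →
      ∀ s ∈ Set.Icc (0 : ℝ) 1, |A h s| ≤ M)
    (hα : IsBddMeas α) {h : ℝ → ℝ} (hh : IsBddMeas h) {a b : ℝ} (ha : 0 ≤ a)
    (hαa : ∀ s ∈ Set.Icc (0 : ℝ) 1, |α s| ≤ a) (hhb : ∀ s ∈ Set.Icc (0 : ℝ) 1, |h s| ≤ b)
    (ℓ : ℕ) : ∀ s ∈ Set.Icc (0 : ℝ) 1, |gammaIter α A ℓ h s| ≤ a ^ ℓ * b := by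
  induction ℓ with
  | zero => simpa [gammaIter] using hhb
  | succ ℓ ih =>
    intro s hs
    rw [gammaIter, abs_mul, pow_succ', mul_assoc]
    exact mul_le_mul (hαa s hs) (hA _ (IsBddMeas.gammaIter hAB hα hh ℓ) _ ih s hs) (abs_nonneg _) ha

/-- stability of the iterates `γ^ℓ` under perturbation of `α` and `β`:
if `sup |α| ≤ ᾱ`, `sup |β| ≤ β̄`, `sup |α̂ − α| ≤ c` and `sup |β̂ − β| ≤ c` on `[0,1]`,
then for every `ℓ ≥ 1` and `s ∈ [0,1]`,
`|γ̂^ℓ(β̂,s) − γ^ℓ(β,s)| ≤ c(ᾱ+c)^ℓ + c β̄ ℓ (ᾱ+c)^{ℓ−1}`. -/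
theorem stmt13 (A : (ℝ → ℝ) → ℝ → ℝ)
    (hadd : ∀ f g, IsBddMeas f → IsBddMeas g → A (f + g) = A f + A g)
    (hsmul : ∀ (c : ℝ) (f : ℝ → ℝ), IsBddMeas f → A (c • f) = c • A f)
    (hAB : ∀ h, IsBddMeas h → IsBddMeas (A h))
    (ω : ℝ → ℝ → ℝ)
    (hωmeas : Measurable (Function.uncurry ω))
    (hωpos : ∀ u s, 0 ≤ ω u s)
    (hωint : ∀ s ∈ Set.Icc (0 : ℝ) 1,
      ∫⁻ u in Set.Icc (0 : ℝ) 1, ENNReal.ofReal (ω u s) ≤ 1)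
    (hdom : ∀ h, IsBddMeas h → ∀ s ∈ Set.Icc (0 : ℝ) 1,
      |A h s| ≤ ∫ u in Set.Icc (0 : ℝ) 1, |h u| * ω u s)
    (α αhat β βhat : ℝ → ℝ)
    (hα : IsBddMeas α) (hαhat : IsBddMeas αhat)
    (hβ : IsBddMeas β) (hβhat : IsBddMeas βhat)
    (abar bbar c : ℝ) (habar : 0 ≤ abar) (hbbar : 0 ≤ bbar) (hc : 0 ≤ c)
    (hαb : ∀ s ∈ Set.Icc (0 : ℝ) 1, |α s| ≤ abar)
    (hβb : ∀ s ∈ Set.Icc (0 : ℝ) 1, |β s| ≤ bbar)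
    (hαd : ∀ s ∈ Set.Icc (0 : ℝ) 1, |αhat s - α s| ≤ c)
    (hβd : ∀ s ∈ Set.Icc (0 : ℝ) 1, |βhat s - β s| ≤ c)
    (ℓ : ℕ) (hℓ : 1 ≤ ℓ) (s : ℝ) (hs : s ∈ Set.Icc (0 : ℝ) 1) :
    |gammaIter αhat A ℓ βhat s - gammaIter α A ℓ β s| ≤
      c * (abar + c) ^ ℓ + c * bbar * ℓ * (abar + c) ^ (ℓ - 1) := by
  have hA : ∀ h, IsBddMeas h → ∀ M : ℝ, (∀ u ∈ Set.Icc (0 : ℝ) 1, |h u| ≤ M) →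
      ∀ s ∈ Set.Icc (0 : ℝ) 1, |A h s| ≤ M := fun h hh M hM s hs =>
    (hdom h hh s hs).trans <| setIntegral_abs_mul_le_of_lintegral_le_one measurableSet_Icc
      (hωmeas.comp (measurable_id.prodMk measurable_const)) (fun u => hωpos u s) (hωint s hs)
      ((abs_nonneg _).trans (hM s hs)) hM
  have hsub : ∀ f g, IsBddMeas f → IsBddMeas g → A (f - g) = A f - A g := by
    intro f g hf hg
    have hfg : f - g = f + (-1 : ℝ) • g := by simp [sub_eq_add_neg]
    rw [hfg, hadd _ _ hf (hg.const_smul _), hsmul _ _ hg]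
    simp [sub_eq_add_neg]
  clear hℓ
  induction ℓ generalizing s with
  | zero => simpa [gammaIter] using hβd s hs
  | succ ℓ ih =>
    have hP := IsBddMeas.gammaIter hAB hαhat hβhat ℓ
    have hQ := IsBddMeas.gammaIter hAB hα hβ ℓ
    have hK : |αhat s| ≤ abar + c := by
      have := abs_add_le (α s) (αhat s - α s)
      rw [add_sub_cancel] at this
      exact this.trans (add_le_add (hαb s hs) (hαd s hs))
    have hdiff := hA _ (hP.sub hQ) _ ih s hs
    have hiter : |A (gammaIter α A ℓ β) s| ≤ (abar + c) ^ ℓ * bbar :=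
      (hA _ hQ _ (abs_gammaIter_le hAB hA hα hβ habar hαb hβb ℓ) s hs).trans (by
        gcongr
        linarith)
    have hsplit : gammaIter αhat A (ℓ + 1) βhat s - gammaIter α A (ℓ + 1) β s =
        αhat s * A (gammaIter αhat A ℓ βhat - gammaIter α A ℓ β) s +
          (αhat s - α s) * A (gammaIter α A ℓ β) s := by
      rw [hsub _ _ hP hQ, gammaIter, gammaIter, Pi.sub_apply]
      ring
    rw [hsplit]
    refine (abs_add_le _ _).trans ?_
    rw [abs_mul, abs_mul]
    refine (add_le_add
      (mul_le_mul hK hdiff (abs_nonneg _) (add_nonneg habar hc))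
      (mul_le_mul (hαd s hs) hiter (abs_nonneg _) hc)).trans (le_of_eq ?_)
    cases ℓ with
    | zero => simp; ring
    | succ k =>
      simp only [add_tsub_cancel_right]
      push_cast
      ring
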